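/- Let p be a prime and Q a connected quandle with Nat.card Q = p^2. Then Q is affine. -/

import Mathlib

open Quandles

/-- Left multiplication by `a` as a permutation of the quandle. -/
def QL {Q : Type*} [Quandle Q] (a : Q) : Equiv.Perm Q := Rack.act' a

/-- The displacement group of a quandle: the subgroup of `Equiv.Perm Q`
generated by `{L a * (L b)⁻¹ : a, b ∈ Q}`. -/
def Dis (Q : Type*) [Quandle Q] : Subgroup (Equiv.Perm Q) :=
  Subgroup.closure {g : Equiv.Perm Q | ∃ a b : Q, g = QL a * (QL b)⁻¹}

universe u

/-- A quandle is affine if it is isomorphic to `Aff(A, f)` for some abelian group `A`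
and automorphism `f` of `A`. -/
def IsAffine (Q : Type u) [Quandle Q] : Prop :=
  ∃ (A : Type u) (_ : AddCommGroup A) (f : A ≃+ A) (e : Q ≃ A),
    ∀ x y : Q, e (x ◃ y) = e x - f (e x) + f (e y)



open scoped BigOperators

/-- trace of left mult. on a product of matrix algebras -/
theorem trace_mulLeft_pi_matrix {m : ℕ} (d : Fin m → ℕ)
    (a : Π i, Matrix (Fin (d i)) (Fin (d i)) ℂ) :
    LinearMap.trace ℂ _ (LinearMap.mulLeft ℂ a) = ∑ i, (d i : ℂ) * (a i).trace := by
  classical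
  let b := Pi.basis (fun i => Matrix.stdBasis ℂ (Fin (d i)) (Fin (d i)))
  rw [LinearMap.trace_eq_matrix_trace ℂ b, Matrix.trace, Fintype.sum_sigma]
  refine Finset.sum_congr rfl fun i _ => ?_
  rw [Fintype.sum_prod_type]
  have : ∀ (k l : Fin (d i)), (LinearMap.toMatrix b b (LinearMap.mulLeft ℂ a)).diag ⟨i, (k, l)⟩
      = a i k k := by
    intro k l
    rw [Matrix.diag_apply, LinearMap.toMatrix_apply]
    simp only [b, Pi.basis_repr, Pi.basis_apply, LinearMap.mulLeft_apply, Pi.mul_apply, Pi.single_eq_same,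
      Matrix.stdBasis_eq_single]
    simp [Matrix.stdBasis]
  rw [Finset.sum_congr rfl fun k _ => Finset.sum_congr rfl fun l _ => this k l]
  simp [Matrix.trace, Finset.mul_sum]

theorem trace_mulLeft_of {G : Type*} [Group G] [Fintype G] [DecidableEq G] (h : G) :
    LinearMap.trace ℂ _ (LinearMap.mulLeft ℂ (MonoidAlgebra.of ℂ G h)) =
      if h = 1 then (Fintype.card G : ℂ) else 0 := by
  let b := MonoidAlgebra.basis G ℂ 
  rw [LinearMap.trace_eq_matrix_trace ℂ b, Matrix.trace]
  have : ∀ g : G, (LinearMap.toMatrix b b (LinearMap.mulLeft ℂ (MonoidAlgebra.of ℂ G h))).diag g =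
      if h = 1 then 1 else 0 := by
    intro g
    rw [Matrix.diag_apply, LinearMap.toMatrix_apply]
    simp only [b, MonoidAlgebra.basis_apply, LinearMap.mulLeft_apply, MonoidAlgebra.of_apply,
      MonoidAlgebra.single_mul_single, MonoidAlgebra.basis]
    simp [Finsupp.single_apply]
  rw [Finset.sum_congr rfl fun g _ => this g]
  simp

/-- The representation data. -/
theorem exists_rep_data (G : Type*) [Group G] [Fintype G] [DecidableEq G] :
    ∃ (m : ℕ) (d : Fin m → ℕ) (ρ : ∀ i, G →* Matrix (Fin (d i)) (Fin (d i)) ℂ),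
      (∀ i, d i ≠ 0) ∧ (∀ i, Submodule.span ℂ (Set.range (ρ i)) = ⊤) ∧
      ∀ g : G, ∑ i, (d i : ℂ) * (ρ i g).trace = if g = 1 then (Fintype.card G : ℂ) else 0 := by
  have : NeZero (Nat.card G : ℂ) := ⟨by simp [Nat.card_eq_zero]⟩
  have : Module.Finite ℂ (MonoidAlgebra ℂ G) := Module.Finite.of_basis (MonoidAlgebra.basis G ℂ)
  obtain ⟨m, d, hd, ⟨φ⟩⟩ :=
    IsSemisimpleRing.exists_algEquiv_pi_matrix_of_isAlgClosed ℂ (MonoidAlgebra ℂ G)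
  let ψ : ∀ i, MonoidAlgebra ℂ G →ₐ[ℂ] Matrix (Fin (d i)) (Fin (d i)) ℂ := fun i =>
    (Pi.evalAlgHom ℂ _ i).comp φ.toAlgHom
  refine ⟨m, d, fun i => (ψ i : MonoidAlgebra ℂ G →* _).comp (MonoidAlgebra.of ℂ G),
    fun i => (hd i).out, fun i => ?_, fun g => ?_⟩
  · have h1 : Set.range ((ψ i : MonoidAlgebra ℂ G →* _).comp (MonoidAlgebra.of ℂ G)) =
        (ψ i).toLinearMap '' Set.range (MonoidAlgebra.basis G ℂ) := by
      rw [← Set.range_comp]; congr 1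
    rw [h1, Submodule.span_image, Module.Basis.span_eq, Submodule.map_top, LinearMap.range_eq_top]
    intro M
    obtain ⟨z, hz⟩ := φ.surjective (Pi.single i M)
    refine ⟨z, ?_⟩
    simp [ψ, hz]
  · rw [← trace_mulLeft_of, ← LinearMap.trace_conj' _ φ.toLinearEquiv]
    have : φ.toLinearEquiv.conj (LinearMap.mulLeft ℂ (MonoidAlgebra.of ℂ G g)) =
        LinearMap.mulLeft ℂ (φ (MonoidAlgebra.of ℂ G g)) := by
      refine LinearMap.ext fun v => ?_
      simp [LinearEquiv.conj_apply]
    rw [this, trace_mulLeft_pi_matrix]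
    rfl

theorem roots_of_unity_avg {d : ℕ} (hd : d ≠ 0) (z : Fin d → ℂ) {k : ℕ} (hk : k ≠ 0)
    (hz : ∀ i, z i ^ k = 1) (hint : IsIntegral ℤ ((∑ i, z i) / d)) (h0 : ∑ i, z i ≠ 0) :
    ∃ c : ℂ, ∀ i, z i = c := by
  have hd' : (d : ℂ) ≠ 0 := by exact_mod_cast hd
  set α : ℂ := (∑ i, z i) / d with hα
  have hα0 : α ≠ 0 := div_ne_zero h0 hd'
  have hsum : ∑ i, z i = d * α := by rw [hα]; field_simp
  let F := IntermediateField.adjoin ℚ (Set.range z)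
  have : FiniteDimensional ℚ F := by
    have : Finite (Set.range z) := Set.finite_range z
    apply IntermediateField.finiteDimensional_adjoin
    rintro _ ⟨i, rfl⟩
    exact IsIntegral.of_pow (Nat.pos_of_ne_zero hk) (by rw [hz]; exact isIntegral_one)
  have : NumberField F := { to_charZero := inferInstance, to_finiteDimensional := this }
  have hmem : ∀ i, z i ∈ F := fun i => IntermediateField.subset_adjoin _ _ ⟨i, rfl⟩
  let w : Fin d → F := fun i => ⟨z i, hmem i⟩
  let β : F := (∑ i, w i) / d
  have hβ : (β : ℂ) = α := by simp [β, α, w]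
  have hβ0 : β ≠ 0 := by intro h; apply hα0; rw [← hβ, h]; simp
  have hβi : IsIntegral ℤ β := by
    have : IsIntegral ℤ (algebraMap F ℂ β) := by
      change IsIntegral ℤ (β : ℂ); rw [hβ]; exact hint
    exact (isIntegral_algebraMap_iff (algebraMap F ℂ).injective).1 this
  obtain ⟨n, hn, hpow⟩ := NumberField.Embeddings.pow_eq_one_of_norm_le_one F ℂ hβ0 hβi (by
    intro φ
    simp only [β, map_div₀, map_sum, map_natCast]
    rw [norm_div, Complex.norm_natCast, div_le_one (by positivity)]
    refine (norm_sum_le _ _).trans ?_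
    have : ∀ i, ‖φ (w i)‖ = 1 := by
      intro i
      have : φ (w i) ^ k = 1 := by
        rw [← map_pow]
        have : w i ^ k = 1 := Subtype.ext (by simp [w, hz])
        rw [this, map_one]
      exact Complex.norm_eq_one_of_pow_eq_one this hk
    simp [this])
  have hα1 : ‖α‖ = 1 := by
    refine Complex.norm_eq_one_of_pow_eq_one (n := n) ?_ hn.ne'
    rw [← hβ]; exact_mod_cast congrArg (fun t : F => (t : ℂ)) hpow
  have hz1 : ∀ i, ‖z i‖ = 1 := fun i => Complex.norm_eq_one_of_pow_eq_one (hz i) hk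
  refine ⟨α, ?_⟩
  -- real parts
  have hre : ∀ i, ((starRingEnd ℂ α) * z i).re ≤ 1 := by
    intro i
    refine (Complex.re_le_norm _).trans ?_
    simp [hα1, hz1]
  have hcc : (starRingEnd ℂ α) * α = 1 := by
    rw [mul_comm, Complex.mul_conj, Complex.normSq_eq_norm_sq, hα1]; simp
  have hs : ∑ i, ((starRingEnd ℂ α) * z i).re = ∑ i : Fin d, (1 : ℝ) := by
    rw [← Complex.re_sum, ← Finset.mul_sum, hsum, mul_left_comm, hcc]; simp
  have heq := (Finset.sum_eq_sum_iff_of_le (fun i _ => hre i)).1 hs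
  intro i
  have h1 := heq i (Finset.mem_univ _)
  have hn1 : ‖(starRingEnd ℂ α) * z i‖ = 1 := by simp [hα1, hz1]
  have h2 : (starRingEnd ℂ α) * z i = 1 := by
    have := Complex.sq_norm_sub_sq_re ((starRingEnd ℂ α) * z i)
    rw [hn1, h1] at this
    have him : ((starRingEnd ℂ α) * z i).im = 0 := by
      have : ((starRingEnd ℂ α) * z i).im ^ 2 = 0 := by linarith
      exact pow_eq_zero_iff (two_ne_zero) |>.1 this
    exact Complex.ext (by simpa using h1) (by simpa using him)
  calc z i = α * ((starRingEnd ℂ α) * z i) := by rw [← mul_assoc, mul_comm α, hcc, one_mul]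
    _ = α := by rw [h2, mul_one]

theorem eigen_data {d : ℕ} (M : Matrix (Fin d) (Fin d) ℂ) {k : ℕ} (hM : M ^ k = 1) :
    ∃ z : Fin d → ℂ, (∀ i, z i ^ k = 1) ∧ M.trace = ∑ i, z i ∧
      M.charpoly = ∏ i, (Polynomial.X - Polynomial.C (z i)) := by
  have hs : M.charpoly.Splits := IsAlgClosed.splits _
  have hcard : M.charpoly.roots.toList.length = d := by
    rw [Multiset.length_toList, ← hs.natDegree_eq_card_roots, Matrix.charpoly_natDegree_eq_dim]; simp
  obtain ⟨l, hl⟩ : ∃ l, l = M.charpoly.roots.toList := ⟨_, rfl⟩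
  rw [← hl] at hcard
  have hl' : (l : Multiset ℂ) = M.charpoly.roots := by rw [hl]; simp
  subst hcard
  refine ⟨l.get, ?_, ?_, ?_⟩
  · intro i
    have hmem : l.get i ∈ M.charpoly.roots := by rw [← hl']; simp
    have hspec : l.get i ∈ spectrum ℂ M := by
      rw [Matrix.mem_spectrum_iff_isRoot_charpoly]
      exact Polynomial.isRoot_of_mem_roots hmem
    have : (l.get i) ^ k ∈ spectrum ℂ (M ^ k) := spectrum.pow_mem_pow M k hspec
    rw [hM] at this
    by_contra hne
    rw [spectrum.mem_iff] at this
    apply this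
    have e : algebraMap ℂ (Matrix (Fin l.length) (Fin l.length) ℂ) (l.get i ^ k) - 1 =
      algebraMap ℂ _ (l.get i ^ k - 1) := by simp
    rw [e]
    exact (IsUnit.mk0 _ (sub_ne_zero.2 hne)).map _
  · rw [Matrix.trace_eq_sum_roots_charpoly, ← hl', Multiset.sum_coe]
    simp [← List.sum_ofFn]
  · rw [hs.eq_prod_roots_of_monic M.charpoly_monic, ← hl', Multiset.map_coe, Multiset.prod_coe,
      ← List.prod_ofFn]
    congr 1
    apply List.ext_get <;> simp

theorem isIntegral_trace {d : ℕ} (M : Matrix (Fin d) (Fin d) ℂ) {k : ℕ} (hk : k ≠ 0)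
    (hM : M ^ k = 1) : IsIntegral ℤ M.trace := by
  obtain ⟨z, hz, ht, -⟩ := eigen_data M hM
  rw [ht]
  exact IsIntegral.sum _ fun i _ => 
    IsIntegral.of_pow (Nat.pos_of_ne_zero hk) (by rw [hz]; exact isIntegral_one)

open Polynomial in
theorem scalar_of_integral {d : ℕ} (hd : d ≠ 0) (M : Matrix (Fin d) (Fin d) ℂ) {k : ℕ} (hk : k ≠ 0)
    (hM : M ^ k = 1) (hint : IsIntegral ℤ (M.trace / d)) (h0 : M.trace ≠ 0) :
    ∃ c : ℂ, M = c • 1 := by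
  obtain ⟨z, hz, ht, hc⟩ := eigen_data M hM
  rw [ht] at hint h0
  obtain ⟨c, hcz⟩ := roots_of_unity_avg hd z hk hz hint h0
  refine ⟨c, ?_⟩
  have hck : c ^ k = 1 := by
    have i : Fin d := ⟨0, Nat.pos_of_ne_zero hd⟩
    rw [← hcz i]; exact hz i
  have hcp : M.charpoly = (X - C c) ^ d := by rw [hc]; simp [hcz]
  have hsq : Squarefree (X ^ k - 1 : ℂ[X]) := by
    have : (X ^ k - C 1 : ℂ[X]).Separable := separable_X_pow_sub_C 1 (by exact_mod_cast hk) one_ne_zero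
    simpa using this.squarefree
  have h1 : minpoly ℂ M ∣ (X - C c) ^ d := hcp ▸ Matrix.minpoly_dvd_charpoly M
  have h2 : minpoly ℂ M ∣ X ^ k - 1 := minpoly.dvd _ _ (by simp [hM])
  have h3 : minpoly ℂ M ∣ X - C c :=
    ((hsq.squarefree_of_dvd h2).isRadical) d _ h1 |> fun h => h
  have h4 : aeval M (X - C c) = 0 := by
    obtain ⟨r, hr⟩ := h3
    rw [hr, map_mul, minpoly.aeval, zero_mul]
  rw [map_sub, aeval_X, aeval_C, sub_eq_zero, Algebra.algebraMap_eq_smul_one] at h4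
  exact h4

theorem perm_card_dvd {X : Type*} [Fintype X] [DecidableEq X] (σ : Equiv.Perm X) {q : ℕ}
    (hq : q.Prime) (s k : ℕ) (h1 : σ ^ (q ^ s) = 1) (h2 : ∀ x, (σ ^ (q ^ k)) x ≠ x) :
    q ^ (k + 1) ∣ Fintype.card X := by
  have hsupp : σ.support = Finset.univ := by
    ext x
    simp only [Equiv.Perm.mem_support, Finset.mem_univ, iff_true]
    intro h
    exact h2 x (Equiv.Perm.pow_apply_eq_self_of_apply_eq_self h _)
  rw [← Finset.card_univ, ← hsupp, ← Equiv.Perm.sum_cycleType]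
  refine Multiset.dvd_sum fun n hn => ?_
  have hn' := hn
  rw [Equiv.Perm.cycleType_def, Multiset.mem_map] at hn
  obtain ⟨c, hc, rfl⟩ := hn
  rw [Finset.mem_val, Equiv.Perm.mem_cycleFactorsFinset_iff] at hc
  obtain ⟨hcyc, hcs⟩ := hc
  obtain ⟨x, hx⟩ := hcyc.nonempty_support
  have hfix : (σ ^ c.support.card) x = x := by
    have h3 : ∀ j : ℕ, (σ ^ j) x = (c ^ j) x := by
      intro j
      induction j with
      | zero => simp
      | succ j ih =>
        rw [pow_succ', pow_succ', Equiv.Perm.mul_apply, Equiv.Perm.mul_apply, ih]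
        refine (hcs _ ?_).symm
        rw [Equiv.Perm.pow_apply_mem_support]; exact hx
    rw [h3, ← hcyc.orderOf, pow_orderOf_eq_one]; rfl
  have hdvd : c.support.card ∣ q ^ s :=
    (Equiv.Perm.dvd_of_mem_cycleType hn').trans (orderOf_dvd_of_pow_eq_one h1)
  obtain ⟨r, -, hr⟩ := (Nat.dvd_prime_pow hq).1 hdvd
  rw [Function.comp, hr]
  rw [hr] at hfix
  apply pow_dvd_pow
  by_contra hlt
  push Not at hlt
  apply h2 x
  have : q ^ k = q ^ r * q ^ (k - r) := by rw [← pow_add]; congr 1; omega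
  rw [this, pow_mul]
  exact Equiv.Perm.pow_apply_eq_self_of_apply_eq_self hfix _

/-- ordered product of the first `n` values -/
def seqProd {G : Type*} [Group G] (h : ℕ → G) (n : ℕ) : G := ((List.range n).map h).prod

theorem seqProd_add {G : Type*} [Group G] (h : ℕ → G) (a b : ℕ) :
    seqProd h (a + b) = seqProd h a * seqProd (fun i => h (a + i)) b := by
  simp [seqProd, List.range_add, Function.comp_def]

theorem seqProd_periodic {G : Type*} [Group G] (h : ℕ → G) (a m : ℕ) (hp : ∀ i, h (a + i) = h i) :
    seqProd h (a * m) = seqProd h a ^ m := by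
  induction m with
  | zero => simp [seqProd]
  | succ m ih =>
    rw [Nat.mul_succ, Nat.add_comm, seqProd_add, pow_succ', ← ih]
    simp [hp]

theorem sum_pow_fin {G R : Type*} [Group G] [Ring R] (C : Finset G) (ρ : G →* R) (n : ℕ) :
    (∑ c ∈ C, ρ c) ^ n = ∑ f : Fin n → C, ρ (List.ofFn fun i => (f i : G)).prod := by
  induction n with
  | zero => simp
  | succ n ih =>
    rw [pow_succ', ih, ← (Fin.consEquiv (fun _ => (C : Type _))).sum_comp, Fintype.sum_prod_type,
      ← Finset.sum_coe_sort, Finset.sum_mul]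
    refine Finset.sum_congr rfl fun c _ => ?_
    rw [Finset.mul_sum]
    refine Finset.sum_congr rfl fun f _ => ?_
    simp [Fin.consEquiv, List.ofFn_succ]

theorem sum_pow_zmod {G R : Type*} [Group G] [Ring R] (C : Finset G) (ρ : G →* R) (n : ℕ) [NeZero n] :
    (∑ c ∈ C, ρ c) ^ n = ∑ f : ZMod n → C, ρ (seqProd (fun k => (f (k : ZMod n) : G)) n) := by
  rw [sum_pow_fin]
  obtain ⟨m, rfl⟩ : ∃ m, n = m + 1 := ⟨n - 1, by have := NeZero.ne n; omega⟩
  refine Finset.sum_congr rfl fun f _ => ?_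
  congr 1
  rw [seqProd]
  congr 1
  apply List.ext_get
  · simp
  · intro j h1 h2
    simp only [List.get_eq_getElem, List.getElem_ofFn, List.getElem_map, List.getElem_range]
    congr 2
    ext
    simp only [List.length_ofFn] at h1
    have := ZMod.val_natCast_of_lt h1
    exact this.symm

open Classical in
theorem tuple_count {G : Type*} [Group G] [Fintype G] (C : Finset G) (y : G) {q : ℕ}
    (hq : q.Prime) (hy : orderOf y = q) : ∃ v : ℕ, ∀ k M : ℕ, ∀ [NeZero (M * q ^ (k + v))], 
      q ^ (k + 1) ∣ Fintype.card {f : ZMod (M * q ^ (k + v)) → C //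
        IsConj y (seqProd (fun k => (f (k : ZMod _) : G)) (M * q ^ (k + v)))} := by
  obtain ⟨v, m, hm, hG⟩ := Nat.exists_eq_pow_mul_and_not_dvd (n := Fintype.card G)
    Fintype.card_ne_zero q hq.ne_one
  refine ⟨v, fun k M _ => ?_⟩
  set N := M * q ^ (k + v) with hN
  let X := {f : ZMod N → C // IsConj y (seqProd (fun k => (f (k : ZMod _) : G)) N)}
  let P : (ZMod N → C) → ℕ → G := fun f => seqProd (fun k => (f (k : ZMod _) : G))
  have hconj : ∀ (f : ZMod N → C) (t : ℕ), IsConj (P f N) (P (fun i => f (i + t)) N) := by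
    intro f t
    have e1 : P f (t + N) = P f t * P (fun i => f (i + t)) N := by
      simp only [P]; rw [seqProd_add]; simp [add_comm]
    have e2 : P f (N + t) = P f N * P f t := by
      simp only [P]; rw [seqProd_add]; simp
    rw [add_comm, e2] at e1
    rw [isConj_iff]
    refine ⟨(P f t)⁻¹, ?_⟩
    rw [mul_assoc, inv_inv, e1]; group
  let σ : Equiv.Perm X :=
    { toFun := fun f => ⟨fun i => f.1 (i + (M : ℕ)), f.2.trans (hconj f.1 M)⟩
      invFun := fun f => ⟨fun i => f.1 (i - (M : ℕ)), by
        have := hconj (fun i => f.1 (i - (M : ℕ))) M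
        simp only [add_sub_cancel_right] at this
        exact f.2.trans this.symm⟩
      left_inv := fun f => by ext; simp
      right_inv := fun f => by ext; simp }
  have hσ : ∀ (j : ℕ) (f : X), ((σ ^ j) f).1 = fun i => f.1 (i + ((M * j : ℕ) : ZMod N)) := by
    intro j f
    induction j with
    | zero => simp
    | succ j ih =>
      rw [pow_succ', Equiv.Perm.mul_apply]
      funext i
      change ((σ ^ j) f).1 (i + (M : ℕ)) = _
      rw [ih]
      refine congrArg f.1 ?_
      push_cast; ring
  refine perm_card_dvd σ hq (k + v) k ?_ ?_
  · ext1 f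
    apply Subtype.ext
    rw [hσ, ← hN]
    simp
  · intro f hf
    have h1 := congrArg Subtype.val hf
    rw [hσ] at h1
    have h2 : P f.1 N = P f.1 (M * q ^ k) ^ (q ^ v) := by
      have : N = M * q ^ k * q ^ v := by rw [hN]; ring
      refine (congrArg (P f.1) this).trans ?_
      apply seqProd_periodic
      intro i
      have := congrFun h1 (i : ZMod N)
      rw [← this, Nat.cast_add, add_comm]
    have h3 : (P f.1 N) ^ m = 1 := by
      rw [h2, ← pow_mul, ← hG, pow_card_eq_one]
    have h4 : y ^ m = 1 := by
      obtain ⟨c, hc⟩ := isConj_iff.1 f.2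
      have : (c * y * c⁻¹) ^ m = 1 := by rw [hc]; exact h3
      rw [conj_pow] at this
      simpa using this
    exact hm (hy ▸ orderOf_dvd_of_pow_eq_one h4)

theorem pow_sub_pow_mem_pow {O : Type*} [CommRing O] (I : Ideal O) {q : ℕ} (hqI : (q : O) ∈ I)
    {a b : O} (hab : a - b ∈ I) (s : ℕ) : a ^ q ^ s - b ^ q ^ s ∈ I ^ (s + 1) := by
  induction s with
  | zero => simpa using hab
  | succ s ih =>
    have h0 : a ^ q ^ s - b ^ q ^ s ∈ I := Ideal.pow_le_self (Nat.succ_ne_zero s) ih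
    set A := a ^ q ^ s
    set B := b ^ q ^ s
    rw [pow_succ q, pow_mul, pow_mul, ← (Commute.all A B).geom_sum₂_mul, pow_succ' I]
    refine Ideal.mul_mem_mul ?_ ih
    rw [← Ideal.Quotient.eq_zero_iff_mem] at hqI ⊢
    have hAB : Ideal.Quotient.mk I A = Ideal.Quotient.mk I B := Ideal.Quotient.eq.2 h0
    simp only [map_sum, map_mul, map_pow, hAB, ← pow_add]
    rw [Finset.sum_congr rfl (g := fun _ => (Ideal.Quotient.mk I B) ^ (q - 1))
      (fun i hi => by congr 1; have := Finset.mem_range.1 hi; omega)]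
    rw [Finset.sum_const, Finset.card_range, nsmul_eq_mul]
    rw [map_natCast] at hqI
    rw [hqI, zero_mul]

theorem mem_pow_of_mul_mem_pow {O : Type*} [CommRing O] (I : Ideal O) [I.IsMaximal] {f t : O} (k : ℕ)
    (hf : f ∉ I) (h : f * t ∈ I ^ k) : t ∈ I ^ k := by
  obtain ⟨u, hu⟩ := Ideal.IsMaximal.exists_inv ‹_› hf
  obtain ⟨i, hi, hu⟩ := hu
  have hi' : 1 - i = u * f := by rw [← hu]; ring
  obtain ⟨w, hw⟩ := sub_dvd_pow_sub_pow 1 i k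
  have : t = i ^ k * t + (u * w) * (f * t) := by
    have : (1 - i ^ k) = u * f * w := by rw [← hi', ← hw, one_pow]
    linear_combination t * this
  rw [this]
  exact Ideal.add_mem _ (Ideal.mul_mem_right _ _ (Ideal.pow_mem_pow hi k)) (Ideal.mul_mem_left _ _ h)

open Polynomial Classical in
theorem residue_sum_zero {O : Type*} [CommRing O] [IsDomain O] [IsNoetherianRing O] (I : Ideal O)
    [hI : I.IsMaximal] {q : ℕ} (hq : q.Prime) (hqI : (q : O) ∈ I) {ι : Type*} [Fintype ι]
    (c w : ι → O) (v : ℕ) (h : ∀ k M : ℕ, M ≠ 0 → ∑ i, c i * w i ^ (M * q ^ (k + v)) ∈ I ^ k)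
    (w0 : O) (hw0 : w0 ∉ I) : ∑ i with w i - w0 ∈ I, c i = 0 := by
  have key : ∑ i with w i - w0 ∈ I, c i ∈ ⨅ k : ℕ, I ^ k := by
    rw [Ideal.mem_iInf]
    intro k
    set s := k + v
    let f : O[X] := X * ∏ i with ¬ (w i - w0 ∈ I), (X - C (w i ^ q ^ s))
    have hf0 : f.coeff 0 = 0 := by simp [f]
    have h1 : ∑ i, c i * f.eval (w i ^ q ^ s) ∈ I ^ k := by
      have : ∑ i, c i * f.eval (w i ^ q ^ s) =
          ∑ M ∈ f.support, f.coeff M * ∑ i, c i * w i ^ (M * q ^ s) := by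
        simp_rw [Polynomial.eval_eq_sum, Polynomial.sum, Finset.mul_sum]
        rw [Finset.sum_comm]
        refine Finset.sum_congr rfl fun M _ => Finset.sum_congr rfl fun i _ => ?_
        rw [← pow_mul, mul_comm (q ^ s)]; ring
      rw [this]
      refine Ideal.sum_mem _ fun M hM => Ideal.mul_mem_left _ _ (h k M ?_)
      rintro rfl
      exact (Polynomial.mem_support_iff.1 hM) hf0
    have h2 : ∑ i, c i * f.eval (w i ^ q ^ s) = ∑ i with w i - w0 ∈ I, c i * f.eval (w i ^ q ^ s) := by
      symm
      apply Finset.sum_filter_of_ne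
      intro i _ hne
      by_contra hbad
      apply hne
      have : f.eval (w i ^ q ^ s) = 0 := by
        simp only [f, eval_mul, eval_X, eval_prod, eval_sub, eval_C]
        rw [Finset.prod_eq_zero (i := i) (by simpa using hbad) (sub_self _), mul_zero]
      rw [this, mul_zero]
    have hfne : f.eval (w0 ^ q ^ s) ∉ I := by
      simp only [f, eval_mul, eval_X, eval_prod, eval_sub, eval_C]
      have hp := hI.isPrime
      intro hmem
      rcases hp.mem_or_mem hmem with h3 | h3
      · exact hw0 (hp.mem_of_pow_mem _ h3)
      · rw [hp.prod_mem_iff] at h3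
        obtain ⟨i, hi, h3⟩ := h3
        rw [Finset.mem_filter] at hi
        apply hi.2
        have hF : Fact q.Prime := ⟨hq⟩
        have : CharP (O ⧸ I) q := by
          refine (CharP.charP_iff_prime_eq_zero hq).2 ?_
          rw [← map_natCast (Ideal.Quotient.mk I)]
          exact Ideal.Quotient.eq_zero_iff_mem.2 hqI
        rw [← Ideal.Quotient.eq_zero_iff_mem, map_sub, map_pow, map_pow, ← sub_pow_char_pow] at h3
        have := eq_zero_of_pow_eq_zero h3
        rw [← Ideal.Quotient.eq_zero_iff_mem, map_sub, ← neg_sub, this, neg_zero]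
    apply mem_pow_of_mul_mem_pow I k hfne
    have h4 : f.eval (w0 ^ q ^ s) * ∑ i with w i - w0 ∈ I, c i =
        ∑ i, c i * f.eval (w i ^ q ^ s) -
          ∑ i with w i - w0 ∈ I, c i * (f.eval (w i ^ q ^ s) - f.eval (w0 ^ q ^ s)) := by
      rw [h2, ← Finset.sum_sub_distrib, Finset.mul_sum]
      refine Finset.sum_congr rfl fun i _ => by ring
    rw [h4]
    refine Ideal.sub_mem _ h1 (Ideal.sum_mem _ fun i hi => Ideal.mul_mem_left _ _ ?_)
    rw [Finset.mem_filter] at hi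
    obtain ⟨t, ht⟩ := Polynomial.sub_dvd_eval_sub (w i ^ q ^ s) (w0 ^ q ^ s) f
    rw [ht]
    refine Ideal.mul_mem_right _ _ ?_
    exact Ideal.pow_le_pow_right (by omega) (pow_sub_pow_mem_pow I hqI hi.2 s)
  rw [Ideal.iInf_pow_eq_bot_of_isDomain I hI.ne_top] at key
  exact key

section RepLemmas

variable {G : Type*} [Group G] [Fintype G] {d : ℕ} (ρ : G →* Matrix (Fin d) (Fin d) ℂ)

theorem scalar_of_commute (hspan : Submodule.span ℂ (Set.range ρ) = ⊤)
    (A : Matrix (Fin d) (Fin d) ℂ) (hA : ∀ g, ρ g * A = A * ρ g) : ∃ c : ℂ, A = c • 1 := by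
  have h1 : ∀ B : Matrix (Fin d) (Fin d) ℂ, B * A = A * B := by
    intro B
    have hB : B ∈ Submodule.span ℂ (Set.range ρ) := by rw [hspan]; trivial
    induction hB using Submodule.span_induction with
    | mem B h => obtain ⟨g, rfl⟩ := h; exact hA g
    | zero => simp
    | add B B' _ _ h h' => rw [add_mul, mul_add, h, h']
    | smul c B _ h => rw [smul_mul_assoc, mul_smul_comm, h]
  have h2 : A ∈ Set.range (Matrix.scalar (Fin d)) :=
    Matrix.mem_range_scalar_of_commute_single fun i j _ => h1 _
  obtain ⟨c, hc⟩ := h2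
  refine ⟨c, ?_⟩
  rw [← hc, Matrix.scalar_apply, Matrix.smul_one_eq_diagonal]

theorem dim_one_of_scalar (hd : d ≠ 0) (hspan : Submodule.span ℂ (Set.range ρ) = ⊤)
    (hA : ∀ g, ∃ c : ℂ, ρ g = c • 1) : d = 1 := by
  by_contra hne
  have h1 : ∀ B : Matrix (Fin d) (Fin d) ℂ, ∃ c : ℂ, B = c • 1 := by
    intro B
    have hB : B ∈ Submodule.span ℂ (Set.range ρ) := by rw [hspan]; trivial
    induction hB using Submodule.span_induction with
    | mem B h => obtain ⟨g, rfl⟩ := h; exact hA g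
    | zero => exact ⟨0, by simp⟩
    | add B B' _ _ h h' =>
      obtain ⟨c, rfl⟩ := h; obtain ⟨c', rfl⟩ := h'; exact ⟨c + c', by rw [add_smul]⟩
    | smul c B _ h => obtain ⟨c', rfl⟩ := h; exact ⟨c * c', by rw [mul_smul]⟩
  obtain ⟨c, hc⟩ := h1 (Matrix.single ⟨0, by omega⟩ ⟨0, by omega⟩ 1)
  have e1 := congrFun (congrFun hc ⟨0, by omega⟩) ⟨0, by omega⟩
  have e2 := congrFun (congrFun hc ⟨1, by omega⟩) ⟨1, by omega⟩
  simp [Matrix.single_apply] at e1 e2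
  rw [← e1] at e2
  exact zero_ne_one e2

theorem dim_one_of_trivial (hd : d ≠ 0) (hspan : Submodule.span ℂ (Set.range ρ) = ⊤)
    (h : ∀ g ∈ commutator G, ρ g = 1) : d = 1 := by
  refine dim_one_of_scalar ρ hd hspan fun g => scalar_of_commute ρ hspan _ fun k => ?_
  rw [← map_mul, ← map_mul]
  have h1 : k * g = (k * g * k⁻¹ * g⁻¹) * (g * k) := by group
  have h2 : k * g * k⁻¹ * g⁻¹ ∈ commutator G :=
    Subgroup.commutator_mem_commutator (Subgroup.mem_top _) (Subgroup.mem_top _)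
  rw [h1, map_mul, h _ h2, one_mul]

theorem scalar_all {x : G} (hgen : Subgroup.closure {g | IsConj x g} = ⊤) {c : ℂ}
    (hx : ρ x = c • 1) (g : G) : ∃ c : ℂ, ρ g = c • 1 := by
  have hg : g ∈ Subgroup.closure {g | IsConj x g} := by rw [hgen]; trivial
  induction hg using Subgroup.closure_induction with
  | mem g h =>
    obtain ⟨k, rfl⟩ := isConj_iff.1 h
    refine ⟨c, ?_⟩
    rw [map_mul, map_mul, hx, mul_smul_comm, mul_one, smul_mul_assoc, ← map_mul]; simp
  | one => exact ⟨1, by simp⟩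
  | mul a b _ _ ha hb =>
    obtain ⟨c, hc⟩ := ha; obtain ⟨c', hc'⟩ := hb
    exact ⟨c * c', by rw [map_mul, hc, hc', smul_mul_assoc, one_mul, smul_smul]⟩
  | inv a _ ha =>
    obtain ⟨c, hc⟩ := ha
    have h1 : ρ a * ρ a⁻¹ = 1 := by rw [← map_mul]; simp
    rw [hc, smul_mul_assoc, one_mul] at h1
    by_cases h0 : c = 0
    · refine ⟨0, ?_⟩
      rw [h0, zero_smul] at h1
      have h2 : (1 : Matrix (Fin d) (Fin d) ℂ) = 0 := h1.symm
      rw [zero_smul, ← mul_one (ρ a⁻¹), h2, mul_zero]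
    · exact ⟨c⁻¹, by rw [← h1, smul_smul, inv_mul_cancel₀ h0, one_smul]⟩

theorem isIntegral_scalar (hd : d ≠ 0) (C : Finset G) {w : ℂ} (hw : ∑ c ∈ C, ρ c = w • 1) :
    IsIntegral ℤ w := by
  have : Module.Finite ℤ (MonoidAlgebra ℤ G) := Module.Finite.of_basis (MonoidAlgebra.basis G ℤ)
  let L : MonoidAlgebra ℤ G →ₐ[ℤ] Matrix (Fin d) (Fin d) ℂ := MonoidAlgebra.lift ℤ _ G ρ
  have h1 : IsIntegral ℤ (∑ c ∈ C, MonoidAlgebra.of ℤ G c) := IsIntegral.of_finite ℤ _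
  have h2 := h1.map L
  have h3 : L (∑ c ∈ C, MonoidAlgebra.of ℤ G c) = algebraMap ℂ (Matrix (Fin d) (Fin d) ℂ) w := by
    rw [map_sum, Algebra.algebraMap_eq_smul_one, ← hw]
    simp [L]
  rw [h3] at h2
  have : Nonempty (Fin d) := ⟨⟨0, Nat.pos_of_ne_zero hd⟩⟩
  exact (isIntegral_algebraMap_iff (algebraMap ℂ (Matrix (Fin d) (Fin d) ℂ)).injective).1 h2

theorem trace_conj_eq {a b : G} (h : IsConj a b) : (ρ b).trace = (ρ a).trace := by
  obtain ⟨k, rfl⟩ := isConj_iff.1 h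
  rw [map_mul, Matrix.trace_mul_comm, ← map_mul]
  congr 2; group

theorem sum_commute (C : Finset G) (hC : ∀ g c, c ∈ C → g * c * g⁻¹ ∈ C) (g : G) :
    ρ g * (∑ c ∈ C, ρ c) = (∑ c ∈ C, ρ c) * ρ g := by
  rw [Finset.mul_sum, Finset.sum_mul]
  refine Finset.sum_bij' (fun c _ => g * c * g⁻¹) (fun c _ => g⁻¹ * c * g) (fun c hc => hC g c hc)
    (fun c hc => by simpa using hC g⁻¹ c hc) ?_ ?_ ?_
  · intro c _; group
  · intro c _; group
  · intro c _; rw [← map_mul, ← map_mul]; congr 1; group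

end RepLemmas

theorem count_trivial {G : Type*} [Group G] [Fintype G] [DecidableEq G] {m : ℕ} (d : Fin m → ℕ)
    (ρ : ∀ i, G →* Matrix (Fin (d i)) (Fin (d i)) ℂ) (hd : ∀ i, d i ≠ 0)
    (hspan : ∀ i, Submodule.span ℂ (Set.range (ρ i)) = ⊤)
    (htr : ∀ g : G, ∑ i, (d i : ℂ) * (ρ i g).trace = if g = 1 then (Fintype.card G : ℂ) else 0)
    (H : Subgroup G) [hH : H.Normal] (hcH : commutator G ≤ H)
    (A : Finset (Fin m)) (hA : ∀ i, i ∈ A ↔ ∀ h ∈ H, ρ i h = 1) : A.card = H.index := by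
  classical
  let C : Finset G := Finset.univ.filter (· ∈ H)
  have hCcard : C.card = Nat.card H := by
    rw [Nat.card_eq_fintype_card, Fintype.card_subtype]
  have h1 : ∑ h ∈ C, ∑ i, (d i : ℂ) * (ρ i h).trace = Fintype.card G := by
    rw [Finset.sum_congr rfl fun h _ => htr h, Finset.sum_ite_eq' C 1]
    simp [C, H.one_mem]
  rw [Finset.sum_comm] at h1
  have h2 : ∀ i, ∑ h ∈ C, (d i : ℂ) * (ρ i h).trace = if i ∈ A then (Nat.card H : ℂ) else 0 := by
    intro i
    rw [← Finset.mul_sum, ← Matrix.trace_sum]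
    split_ifs with hi
    · rw [hA] at hi
      have hd1 := dim_one_of_trivial (ρ i) (hd i) (hspan i) fun g hg => hi g (hcH hg)
      rw [Finset.sum_congr rfl (g := fun _ => 1) fun h hh => hi h (by simpa [C] using hh)]
      rw [Finset.sum_const, Matrix.trace_smul, Matrix.trace_one, Fintype.card_fin, hd1, hCcard]
      simp
    · rw [hA] at hi
      push Not at hi
      obtain ⟨h0, hh0, hne⟩ := hi
      obtain ⟨c, hc⟩ := scalar_of_commute (ρ i) (hspan i) (∑ h ∈ C, ρ i h) (sum_commute (ρ i) C
        (fun g c hc => by simpa [C] using hH.conj_mem c (by simpa [C] using hc) g))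
      have h3 : ρ i h0 * ∑ h ∈ C, ρ i h = ∑ h ∈ C, ρ i h := by
        rw [Finset.mul_sum]
        refine Finset.sum_bij' (fun c _ => h0 * c) (fun c _ => h0⁻¹ * c) ?_ ?_ ?_ ?_ ?_
        · intro c hc; simp only [C, Finset.mem_filter, Finset.mem_univ, true_and] at hc ⊢
          exact H.mul_mem hh0 hc
        · intro c hc; simp only [C, Finset.mem_filter, Finset.mem_univ, true_and] at hc ⊢
          exact H.mul_mem (H.inv_mem hh0) hc
        · intro c _; simp
        · intro c _; simp
        · intro c _; simp
      rw [hc] at h3 ⊢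
      have hc0 : c = 0 := by
        by_contra hc0
        apply hne
        rw [mul_smul_comm, mul_one] at h3
        exact smul_right_injective _ hc0 h3
      simp [hc0]
  rw [Finset.sum_congr rfl fun i _ => h2 i] at h1
  rw [Finset.sum_ite_mem, Finset.univ_inter, Finset.sum_const, nsmul_eq_mul] at h1
  have h3 : A.card * Nat.card H = Nat.card G := by
    rw [Nat.card_eq_fintype_card (α := G)]; exact_mod_cast h1
  rw [← H.card_mul_index, mul_comm] at h3
  exact Nat.eq_of_mul_eq_mul_left Nat.card_pos h3

theorem trivial_or_dvd {G : Type*} [Group G] [Fintype G] {d : ℕ}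
    (ρ : G →* Matrix (Fin d) (Fin d) ℂ) (hd : d ≠ 0)
    (hspan : Submodule.span ℂ (Set.range ρ) = ⊤) {x : G}
    (hgen : Subgroup.closure {g | IsConj x g} = ⊤) (C : Finset G) (hC : ∀ g, g ∈ C ↔ IsConj x g)
    {p j : ℕ} (hp : p.Prime) (hcard : C.card = p ^ j) {w : ℂ} (hw : ∑ c ∈ C, ρ c = w • 1)
    (hw0 : w ≠ 0) (hpd : ¬ p ∣ d) : d = 1 ∧ ∀ g ∈ commutator G, ρ g = 1 := by
  have hx1 : (ρ x) ^ Fintype.card G = 1 := by rw [← map_pow, pow_card_eq_one, map_one]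
  have htr : w * d = (p : ℂ) ^ j * (ρ x).trace := by
    have h := congrArg Matrix.trace hw
    rw [Matrix.trace_sum, Finset.sum_congr rfl fun c hc => trace_conj_eq ρ ((hC c).1 hc),
      Finset.sum_const, hcard, Matrix.trace_smul, Matrix.trace_one, Fintype.card_fin] at h
    simp only [nsmul_eq_mul, smul_eq_mul, Nat.cast_pow] at h
    exact h.symm
  have hd' : (d : ℂ) ≠ 0 := by exact_mod_cast hd
  have h0 : (ρ x).trace ≠ 0 := by
    intro h
    rw [h, mul_zero] at htr
    exact mul_ne_zero hw0 hd' htr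
  have hcop : IsCoprime (d : ℤ) ((p ^ j : ℕ) : ℤ) :=
    Nat.isCoprime_iff_coprime.2 (Nat.Coprime.pow_right j ((hp.coprime_iff_not_dvd.2 hpd).symm))
  obtain ⟨a, b, hab⟩ := hcop
  have hab' : (a : ℂ) * d + b * (p : ℂ) ^ j = 1 := by exact_mod_cast hab
  have hint : IsIntegral ℤ ((ρ x).trace / d) := by
    have h1 : (ρ x).trace / d = a * (ρ x).trace + b * w := by
      rw [div_eq_iff hd', add_mul, mul_assoc (b : ℂ), htr]
      linear_combination (-(ρ x).trace) * hab'
    rw [h1]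
    exact (isIntegral_algebraMap (R := ℤ) (x := a) |>.mul
        (isIntegral_trace _ Fintype.card_ne_zero hx1)).add
      ((isIntegral_algebraMap (R := ℤ) (x := b)).mul (isIntegral_scalar ρ hd C hw))
  obtain ⟨c, hc⟩ := scalar_of_integral hd (ρ x) Fintype.card_ne_zero hx1 hint h0
  have hall := scalar_all ρ hgen hc
  refine ⟨dim_one_of_scalar ρ hd hspan hall, ?_⟩
  have hcomm : ∀ a b, ρ a * ρ b = ρ b * ρ a := by
    intro a b
    obtain ⟨s, hs⟩ := hall a
    rw [hs]; simp
  intro g hg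
  have hle : commutator G ≤ ρ.ker := by
    rw [commutator_def, Subgroup.commutator_le]
    intro a _ b _
    rw [MonoidHom.mem_ker, commutatorElement_def, map_mul, map_mul, map_mul, hcomm a b, ← map_mul, ← map_mul,
      ← map_mul]
    simp
  exact hle hg

open Classical in
theorem count_identity {G : Type*} [Group G] [Fintype G] {m : ℕ} (d : Fin m → ℕ)
    (ρ : ∀ i, G →* Matrix (Fin (d i)) (Fin (d i)) ℂ)
    (htr : ∀ g : G, ∑ i, (d i : ℂ) * (ρ i g).trace = if g = 1 then (Fintype.card G : ℂ) else 0)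
    (C Y : Finset G) (y : G) (hY : ∀ g, g ∈ Y ↔ IsConj y g) (w : Fin m → ℂ)
    (hw : ∀ i, ∑ c ∈ C, ρ i c = w i • 1) (N : ℕ) [NeZero N] :
    ∑ i, ((d i : ℂ) * (Y.card * (ρ i y⁻¹).trace)) * w i ^ N = (Fintype.card G : ℂ) *
      (Fintype.card {f : ZMod N → C // IsConj y (seqProd (fun k => (f (k : ZMod _) : G)) N)} : ℕ) := by
  have h1 : ∀ i, ((d i : ℂ) * (Y.card * (ρ i y⁻¹).trace)) * w i ^ N =
      ∑ f : ZMod N → C, ∑ g ∈ Y, (d i : ℂ) *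
        (ρ i (g⁻¹ * seqProd (fun k => (f (k : ZMod _) : G)) N)).trace := by
    intro i
    rw [Finset.sum_comm]
    have h2 : ∀ g ∈ Y, ∑ f : ZMod N → C, (d i : ℂ) *
        (ρ i (g⁻¹ * seqProd (fun k => (f (k : ZMod _) : G)) N)).trace =
        (d i : ℂ) * ((ρ i y⁻¹).trace * w i ^ N) := by
      intro g hg
      have h3 : IsConj y⁻¹ g⁻¹ := by
        obtain ⟨k, hk⟩ := isConj_iff.1 ((hY g).1 hg)
        exact isConj_iff.2 ⟨k, by rw [← hk]; group⟩
      rw [← Finset.mul_sum, ← trace_conj_eq (ρ i) h3]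
      simp only [map_mul]
      rw [← Matrix.trace_sum, ← Finset.mul_sum, ← sum_pow_zmod, hw, smul_pow, one_pow, mul_smul_comm,
        mul_one, Matrix.trace_smul, smul_eq_mul, mul_comm (w i ^ N)]
    rw [Finset.sum_congr rfl h2, Finset.sum_const, nsmul_eq_mul]
    ring
  rw [Finset.sum_congr rfl fun i _ => h1 i, Finset.sum_comm]
  have h4 : ∀ f : ZMod N → C, ∑ i, ∑ g ∈ Y, (d i : ℂ) *
        (ρ i (g⁻¹ * seqProd (fun k => (f (k : ZMod _) : G)) N)).trace =
      if IsConj y (seqProd (fun k => (f (k : ZMod _) : G)) N) then (Fintype.card G : ℂ) else 0 := by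
    intro f
    rw [Finset.sum_comm, Finset.sum_congr rfl fun g _ => htr _]
    simp only [inv_mul_eq_one]
    rw [Finset.sum_ite_eq']
    simp only [hY]
  rw [Finset.sum_congr rfl fun f _ => h4 f, ← Finset.sum_filter, Finset.sum_const, nsmul_eq_mul,
    mul_comm, Fintype.card_subtype]

theorem not_mem_of_coprime {O : Type*} [CommRing O] (I : Ideal O) [hI : I.IsMaximal] {q n : ℕ}
    (hq : q.Prime) (hqI : (q : O) ∈ I) (hn : ¬ q ∣ n) : (n : O) ∉ I := by
  intro h
  have hcop : IsCoprime (q : ℤ) (n : ℤ) := Nat.isCoprime_iff_coprime.2 (hq.coprime_iff_not_dvd.2 hn)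
  obtain ⟨a, b, hab⟩ := hcop
  apply hI.ne_top
  rw [Ideal.eq_top_iff_one]
  have : (1 : O) = a * q + b * n := by exact_mod_cast congrArg (Int.cast : ℤ → O) hab.symm
  rw [this]
  exact I.add_mem (I.mul_mem_left _ hqI) (I.mul_mem_left _ h)

theorem char_trivial {G O : Type*} [Group G] [CommRing O] [IsDomain O] (I : Ideal O)
    [hI : I.IsMaximal] {q : ℕ} (hq : q.Prime) (hqI : (q : O) ∈ I) (l : G →* O) {x : G}
    (hgen : Subgroup.closure {g | IsConj x g} = ⊤) (hx : l x - 1 ∈ I) {n : ℕ} (hn : ¬ q ∣ n) {h : G}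
    (hh : h ^ n ∈ commutator G) : l h = 1 := by
  have hcm : ∀ g ∈ commutator G, l g = 1 := by
    have hle : commutator G ≤ l.ker := by
      rw [commutator_def, Subgroup.commutator_le]
      intro a _ b _
      rw [MonoidHom.mem_ker, commutatorElement_def, map_mul, map_mul, map_mul, mul_comm (l a), ← map_mul,
        ← map_mul, ← map_mul]
      simp
    exact fun g hg => hle hg
  have hall : ∀ g : G, l g - 1 ∈ I := by
    let k : G →* O ⧸ I := (Ideal.Quotient.mk I : O →* O ⧸ I).comp l
    have hk : Subgroup.closure {g | IsConj x g} ≤ k.ker := by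
      rw [Subgroup.closure_le]
      rintro g hg
      obtain ⟨c, rfl⟩ := isConj_iff.1 hg
      have : k x = 1 := by
        have := Ideal.Quotient.eq.2 hx
        simpa [k] using this
      change k _ = 1
      rw [map_mul, map_mul, this, mul_one, ← map_mul]
      simp
    intro g
    have hg : g ∈ k.ker := hk (by rw [hgen]; trivial)
    have : k g = 1 := hg
    rw [← Ideal.Quotient.eq]
    simpa [k] using this
  have h1 : (∑ i ∈ Finset.range n, l h ^ i) * (l h - 1) = 0 := by
    rw [geom_sum_mul, ← map_pow, hcm _ hh, sub_self]
  rcases mul_eq_zero.1 h1 with h2 | h2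
  · exfalso
    apply not_mem_of_coprime I hq hqI hn
    have h3 : ∑ i ∈ Finset.range n, l h ^ i - (n : O) ∈ I := by
      have : ∑ i ∈ Finset.range n, l h ^ i - (n : O) = ∑ i ∈ Finset.range n, (l (h ^ i) - 1) := by
        rw [Finset.sum_sub_distrib]; simp
      rw [this]
      exact I.sum_mem fun i _ => hall _
    rw [h2, zero_sub] at h3
    simpa using I.neg_mem h3
  · exact sub_eq_zero.1 h2

theorem sub_one_mem_of_pow {O : Type*} [CommRing O] (I : Ideal O) [hI : I.IsMaximal] {q r : ℕ}
    (hq : q.Prime) (hqI : (q : O) ∈ I) {z : O} (hz : z ^ q ^ r = 1) : z - 1 ∈ I := by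
  have := Fact.mk hq
  have hch : CharP (O ⧸ I) q := by
    refine ⟨fun n => ?_⟩
    rw [← map_natCast (Ideal.Quotient.mk I), Ideal.Quotient.eq_zero_iff_mem]
    refine ⟨fun h => by_contra fun hn => not_mem_of_coprime I hq hqI hn h, ?_⟩
    rintro ⟨k, rfl⟩
    rw [Nat.cast_mul]
    exact I.mul_mem_right _ hqI
  rw [← Ideal.Quotient.eq_zero_iff_mem]
  have h1 : (Ideal.Quotient.mk I (z - 1)) ^ q ^ r = 0 := by
    rw [map_sub, sub_pow_char_pow, ← map_pow, hz]
    simp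
  exact eq_zero_of_pow_eq_zero h1

theorem dvd_of_integral {z : ℂ} (hz : IsIntegral ℤ z) {n : ℕ} (hn : n ≠ 0) {a : ℤ}
    (h : (n : ℂ) * z = a) : (n : ℤ) ∣ a := by
  have hn' : (n : ℂ) ≠ 0 := by exact_mod_cast hn
  have h1 : z = algebraMap ℚ ℂ ((a : ℚ) / n) := by
    rw [eq_ratCast]; push_cast
    rw [eq_div_iff hn', mul_comm]; exact h
  rw [h1, isIntegral_algebraMap_iff (algebraMap ℚ ℂ).injective,
    IsIntegrallyClosed.isIntegral_iff] at hz
  obtain ⟨b, hb⟩ := hz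
  refine ⟨b, ?_⟩
  have hn2 : (n : ℚ) ≠ 0 := by exact_mod_cast hn
  have h2 : (b : ℚ) = (a : ℚ) / n := by simpa using hb
  rw [eq_div_iff hn2] at h2
  have : (a : ℚ) = n * b := by rw [← h2]; ring
  exact_mod_cast this

theorem trace_mul_dim_one {d : ℕ} (h : d = 1) (A B : Matrix (Fin d) (Fin d) ℂ) :
    (A * B).trace = A.trace * B.trace := by
  subst h
  simp [Matrix.trace, Matrix.mul_apply]

theorem eq_one_dim_one {d : ℕ} (h : d = 1) (A : Matrix (Fin d) (Fin d) ℂ) (hA : A.trace = 1) :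
    A = 1 := by
  subst h
  ext i j
  fin_cases i; fin_cases j
  simpa [Matrix.trace] using hA

/-- An auxiliary normal subgroup whose index is prime to `p`. -/
theorem exists_sub (G : Type*) [Group G] [Fintype G] {p q r n : ℕ} (hp : p.Prime) (hq : q.Prime)
    (hpq : q ≠ p) (hG : Fintype.card G = q ^ r * n) : ∃ H : Subgroup G, H.Normal ∧
      commutator G ≤ H ∧ ¬ p ∣ H.index ∧ (∀ h ∈ H, h ^ n ∈ commutator G) ∧
      ∀ g : G, g ^ q ^ r ∈ H := by
  let θ : G →* Abelianization G := (powMonoidHom n).comp Abelianization.of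
  have hθ : ∀ g, θ g = Abelianization.of (g ^ n) := fun g => by simp [θ]
  have hk : ∀ g : G, Abelianization.of g = 1 ↔ g ∈ commutator G := by
    intro g
    rw [← MonoidHom.mem_ker, Abelianization.ker_of]
  have hpw : ∀ g : G, θ g ^ q ^ r = 1 := by
    intro g
    rw [hθ, ← map_pow, ← pow_mul, mul_comm, ← hG, pow_card_eq_one, map_one]
  refine ⟨θ.ker, inferInstance, Abelianization.commutator_subset_ker θ, ?_, ?_, ?_⟩
  · intro h
    rw [Subgroup.index_ker] at h
    have := Fact.mk hp
    obtain ⟨⟨t, g, rfl⟩, ht⟩ := exists_prime_orderOf_dvd_card' p h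
    have h1 : p ∣ q ^ r := by
      rw [← ht]
      apply orderOf_dvd_of_pow_eq_one
      ext
      simpa using hpw g
    exact hpq ((Nat.prime_dvd_prime_iff_eq hp hq).1 (hp.dvd_of_dvd_pow h1)).symm
  · intro h hh
    rw [← hk, ← hθ]; exact hh
  · intro g
    rw [MonoidHom.mem_ker, map_pow, hpw]

theorem exists_ring (S : Set ℂ) (hf : S.Finite) (hS : ∀ z ∈ S, IsIntegral ℤ z) {q : ℕ}
    (hq : q.Prime) : ∃ O : Subalgebra ℤ ℂ, S ⊆ O ∧ IsNoetherianRing O ∧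
      ∃ I : Ideal O, I.IsMaximal ∧ (q : O) ∈ I := by
  refine ⟨Algebra.adjoin ℤ S, Algebra.subset_adjoin, ?_, ?_⟩
  · have h1 : IsNoetherian ℤ (Algebra.adjoin ℤ S) :=
      isNoetherian_of_fg_of_noetherian _ (fg_adjoin_of_finite hf hS)
    exact isNoetherian_of_tower ℤ h1
  · have hle : Algebra.adjoin ℤ S ≤ integralClosure ℤ ℂ := by
      rw [Algebra.adjoin_le_iff]; exact hS
    obtain ⟨I, hI, h⟩ := exists_max_ideal_of_mem_nonunits (a := (q : Algebra.adjoin ℤ S)) (by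
      intro hu
      obtain ⟨z, hz⟩ := hu.exists_right_inv
      have h1 : (q : ℤ) ∣ 1 := by
        refine dvd_of_integral (z := (z : ℂ)) (hle z.2) hq.ne_zero ?_
        have := congrArg (Subtype.val) hz
        simpa using this
      have h2 : q ∣ 1 := by exact_mod_cast h1
      exact hq.one_lt.ne' (Nat.dvd_one.1 h2))
    exact ⟨I, hI, h⟩

theorem burnside_like {G : Type*} [Group G] [Fintype G] {x y : G} {p q j : ℕ} (hp : p.Prime)
    (hq : q.Prime) (hpq : q ≠ p) (hgen : Subgroup.closure {g | IsConj x g} = ⊤)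
    (hcard : Nat.card {g | IsConj x g} = p ^ j) (hy : y ∈ commutator G) (hyq : orderOf y = q) :
    False := by
  classical
  obtain ⟨m, d, ρ, hd, hspan, htr⟩ := exists_rep_data G
  let C : Finset G := Finset.univ.filter fun g => IsConj x g
  have hC : ∀ g, g ∈ C ↔ IsConj x g := by simp [C]
  let Y : Finset G := Finset.univ.filter fun g => IsConj y g
  have hY : ∀ g, g ∈ Y ↔ IsConj y g := by simp [Y]
  have hCcard : C.card = p ^ j := by
    rw [← hcard, Nat.card_eq_fintype_card, Fintype.card_ofFinset]
    congr 1
  have hCconj : ∀ g c, c ∈ C → g * c * g⁻¹ ∈ C := by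
    intro g c hc
    rw [hC] at hc ⊢
    exact hc.trans (isConj_iff.2 ⟨g, rfl⟩)
  have hw : ∀ i, ∃ w : ℂ, ∑ c ∈ C, ρ i c = w • 1 := fun i =>
    scalar_of_commute (ρ i) (hspan i) _ (sum_commute (ρ i) C hCconj)
  choose w hw using hw
  obtain ⟨O, hSO, hnoeth, I, hI, hqI⟩ := exists_ring
    (Set.range w ∪ Set.range fun a : Fin m × G => (ρ a.1 a.2).trace)
    ((Set.finite_range _).union (Set.finite_range _)) (by
      rintro z (⟨i, rfl⟩ | ⟨⟨i, g⟩, rfl⟩)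
      · exact isIntegral_scalar (ρ i) (hd i) C (hw i)
      · exact isIntegral_trace _ Fintype.card_ne_zero
          (by rw [← map_pow, pow_card_eq_one, map_one] : (ρ i g) ^ Fintype.card G = 1)) hq
  have hwO : ∀ i, w i ∈ O := fun i => hSO (Or.inl ⟨i, rfl⟩)
  have hχO : ∀ i g, (ρ i g).trace ∈ O := fun i g => hSO (Or.inr ⟨(i, g), rfl⟩)
  let w' : Fin m → O := fun i => ⟨w i, hwO i⟩
  let χ' : Fin m → G → O := fun i g => ⟨(ρ i g).trace, hχO i g⟩
  have hχint : ∀ i g, IsIntegral ℤ (ρ i g).trace := fun i g =>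
    isIntegral_trace _ Fintype.card_ne_zero
          (by rw [← map_pow, pow_card_eq_one, map_one] : (ρ i g) ^ Fintype.card G = 1)
  let w0 : O := ((p ^ j : ℕ) : O)
  have hw0 : w0 ∉ I := by
    apply not_mem_of_coprime I hq hqI
    intro h
    exact hpq ((Nat.prime_dvd_prime_iff_eq hq hp).1 (hq.dvd_of_dvd_pow h))
  obtain ⟨v, hv⟩ := tuple_count C y hq hyq
  have hsum := residue_sum_zero I hq hqI
    (fun i => ((d i : ℕ) : O) * ((Y.card : O) * χ' i y⁻¹)) w' v (by
      intro k M hM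
      have : NeZero (M * q ^ (k + v)) := ⟨mul_ne_zero hM (pow_ne_zero _ hq.ne_zero)⟩
      obtain ⟨t, ht⟩ := hv k M
      have h1 := count_identity d ρ htr C Y y hY w hw (M * q ^ (k + v))
      rw [ht] at h1
      have h2 : ∑ i, (((d i : ℕ) : O) * ((Y.card : O) * χ' i y⁻¹)) * w' i ^ (M * q ^ (k + v)) =
          (Fintype.card G : O) * ((q ^ (k + 1) * t : ℕ) : O) := by
        apply Subtype.ext
        push_cast
        push_cast at h1
        exact h1
      rw [h2]
      push_cast
      refine Ideal.mul_mem_left _ _ (Ideal.mul_mem_right _ _ ?_)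
      exact Ideal.pow_le_pow_right (Nat.le_succ k) (Ideal.pow_mem_pow hqI _)) w0 hw0
  set I' : Finset (Fin m) := Finset.univ.filter fun i => w' i - w0 ∈ I with hI'
  have hYne : (Y.card : ℂ) ≠ 0 := by
    have : 0 < Y.card := Finset.card_pos.2 ⟨y, (hY y).2 (IsConj.refl y)⟩
    exact_mod_cast this.ne'
  have hsum2 : ∑ i ∈ I', (d i : ℂ) * (ρ i y⁻¹).trace = 0 := by
    have h1 := congrArg (Subtype.val) hsum
    push_cast at h1
    have h2 : (Y.card : ℂ) * ∑ i ∈ I', (d i : ℂ) * (ρ i y⁻¹).trace = 0 := by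
      rw [Finset.mul_sum, ← h1]
      refine Finset.sum_congr rfl fun i _ => ?_
      ring
    exact (mul_eq_zero.1 h2).resolve_left hYne
  -- degree-one alternatives
  have hlin : ∀ i ∈ I', ¬ p ∣ d i → d i = 1 ∧ ∀ g ∈ commutator G, ρ i g = 1 := by
    intro i hi hpd
    refine trivial_or_dvd (ρ i) (hd i) (hspan i) hgen C hC hp hCcard (hw i) ?_ hpd
    intro h0
    have h1 : w' i - w0 ∈ I := by simpa [hI'] using hi
    have h2 : w' i = 0 := Subtype.ext h0
    rw [h2, zero_sub] at h1
    exact hw0 (by simpa using I.neg_mem h1)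
  obtain ⟨r, n, hn, hG⟩ := Nat.exists_eq_pow_mul_and_not_dvd (n := Fintype.card G)
    Fintype.card_ne_zero q hq.ne_one
  obtain ⟨H, hHn, hcH, hpH, hH1, hH2⟩ := exists_sub G hp hq hpq hG
  let A : Finset (Fin m) := I'.filter fun i => ¬ p ∣ d i
  -- linear characters
  let lam : ∀ i, d i = 1 → (G →* O) := fun i h1 =>
    { toFun := χ' i
      map_one' := Subtype.ext (by simp [χ', h1])
      map_mul' := fun a b => Subtype.ext (by
        change (ρ i (a * b)).trace = (ρ i a).trace * (ρ i b).trace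
        rw [map_mul, trace_mul_dim_one h1]) }
  have hwlam : ∀ i (h1 : d i = 1), w' i = w0 * lam i h1 x := by
    intro i h1
    apply Subtype.ext
    change w i = (((p ^ j : ℕ) : O) : ℂ) * (ρ i x).trace
    have h1' : (d i : ℂ) = 1 := by exact_mod_cast h1
    have h := congrArg Matrix.trace (hw i)
    rw [Matrix.trace_sum, Finset.sum_congr rfl fun c hc => trace_conj_eq (ρ i) ((hC c).1 hc),
      Finset.sum_const, hCcard, Matrix.trace_smul, Matrix.trace_one, Fintype.card_fin, h1'] at h
    simp only [nsmul_eq_mul, smul_eq_mul, mul_one] at h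
    rw [← h]
    simp
  have hA : ∀ i, i ∈ A ↔ ∀ h ∈ H, ρ i h = 1 := by
    intro i
    constructor
    · intro hi h hh
      obtain ⟨hi1, hi2⟩ := Finset.mem_filter.1 hi
      obtain ⟨h1, h2⟩ := hlin i hi1 hi2
      apply eq_one_dim_one h1
      have h3 : w' i - w0 ∈ I := by simpa [hI'] using hi1
      have h4 : w0 * (lam i h1 x - 1) ∈ I := by
        rw [mul_sub, ← hwlam i h1, mul_one]; exact h3
      have h5 : lam i h1 x - 1 ∈ I := (hI.isPrime.mem_or_mem h4).resolve_left hw0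
      have h6 := char_trivial I hq hqI (lam i h1) hgen h5 hn (hH1 h hh)
      exact congrArg Subtype.val h6
    · intro hi
      have h1 := dim_one_of_trivial (ρ i) (hd i) (hspan i) fun g hg => hi g (hcH hg)
      have h2 : lam i h1 x ^ q ^ r = 1 := by
        rw [← map_pow]
        apply Subtype.ext
        change (ρ i _).trace = 1
        rw [hi _ (hH2 x)]
        simp [h1]
      have h3 := sub_one_mem_of_pow I hq hqI h2
      refine Finset.mem_filter.2 ⟨?_, ?_⟩
      · rw [hI', Finset.mem_filter]
        refine ⟨Finset.mem_univ _, ?_⟩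
        have : w' i - w0 = w0 * (lam i h1 x - 1) := by rw [hwlam i h1]; ring
        rw [this]
        exact I.mul_mem_left _ h3
      · rw [h1]; exact hp.one_lt.ne' ∘ Nat.dvd_one.1
  have hAcard := count_trivial d ρ hd hspan htr H hcH A hA
  rw [← Finset.sum_filter_not_add_sum_filter I' (fun i => p ∣ d i)] at hsum2
  have hs1 : ∑ i ∈ I' with ¬ p ∣ d i, (d i : ℂ) * (ρ i y⁻¹).trace = A.card := by
    rw [Finset.sum_congr rfl (g := fun _ => (1 : ℂ))]
    · simp [A]
    · intro i hi
      obtain ⟨hi1, hi2⟩ := Finset.mem_filter.1 hi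
      obtain ⟨h1, h2⟩ := hlin i hi1 hi2
      rw [h2 _ (inv_mem hy)]
      simp [h1]
  have hs2 : ∑ i ∈ I' with p ∣ d i, (d i : ℂ) * (ρ i y⁻¹).trace =
      (p : ℂ) * ∑ i ∈ I' with p ∣ d i, ((d i / p : ℕ) : ℂ) * (ρ i y⁻¹).trace := by
    rw [Finset.mul_sum]
    refine Finset.sum_congr rfl fun i hi => ?_
    obtain ⟨hi1, hi2⟩ := Finset.mem_filter.1 hi
    rw [← mul_assoc, ← Nat.cast_mul, Nat.mul_div_cancel' hi2]
  rw [hs1, hs2] at hsum2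
  have hint : IsIntegral ℤ (∑ i ∈ I' with p ∣ d i, ((d i / p : ℕ) : ℂ) * (ρ i y⁻¹).trace) := by
    refine IsIntegral.sum _ fun i _ => IsIntegral.mul ?_ (hχint _ _)
    exact (isIntegral_algebraMap (R := ℤ) (A := ℂ) (x := ((d i / p : ℕ) : ℤ)))
  have hdvd := dvd_of_integral hint hp.ne_zero (a := -(A.card : ℤ)) (by
    push_cast
    linear_combination hsum2)
  rw [dvd_neg, hAcard] at hdvd
  exact hpH (by exact_mod_cast hdvd)

theorem comm_of_cyclic_abelianization (G : Type*) [Group G] [hN : Group.IsNilpotent G]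
    (hcyc : IsCyclic (Abelianization G)) : ∀ a b : G, a * b = b * a := by
  revert hcyc
  refine Group.nilpotent_center_quotient_ind (P := fun G _ _ => IsCyclic (Abelianization G) →
    ∀ a b : G, a * b = b * a) G ?_ ?_
  · intro G _ _ _ a b
    exact Subsingleton.elim _ _
  · intro G _ _ ih hcyc
    let F : Abelianization G →* Abelianization (G ⧸ Subgroup.center G) :=
      Abelianization.map (QuotientGroup.mk' _)
    have hF : Function.Surjective F := by
      intro t
      obtain ⟨t, rfl⟩ := QuotientGroup.mk'_surjective (commutator _) t
      obtain ⟨t, rfl⟩ := QuotientGroup.mk'_surjective _ t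
      exact ⟨Abelianization.of t, rfl⟩
    have h1 := ih (isCyclic_of_surjective F hF)
    have hle : commutator G ≤ Subgroup.center G := by
      rw [commutator_def, Subgroup.commutator_le]
      intro a _ b _
      rw [← QuotientGroup.eq_one_iff, commutatorElement_def]
      have := h1 (a : G ⧸ Subgroup.center G) b
      change (a : G ⧸ Subgroup.center G) * b * (a : G ⧸ Subgroup.center G)⁻¹ *
        (b : G ⧸ Subgroup.center G)⁻¹ = 1
      rw [this]; group
    exact commutative_of_cyclic_center_quotient Abelianization.of
      (by rw [Abelianization.ker_of]; exact hle)

theorem comm_of_data {D Q : Type*} [Group D] [Finite D] [MulAction D Q] [FaithfulSMul D Q]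
    [MulAction.IsPretransitive D Q] {p : ℕ} (hp : p.Prime) (hcard : Nat.card Q = p ^ 2)
    (hD : IsPGroup p D) (φ : D →* D) (a : Q) (hfix : ∀ g : D, g • a = a → φ g = g)
    (hgen : Subgroup.closure {z | ∃ g, z = g * (φ g)⁻¹} = ⊤) : ∀ g h : D, g * h = h * g := by
  have := Fact.mk hp
  have hnil : Group.IsNilpotent D := hD.isNilpotent
  let ψ : Abelianization D →* Abelianization D := MonoidHom.id _ / Abelianization.map φ
  have hψ : ∀ g, ψ (Abelianization.of g) = Abelianization.of (g * (φ g)⁻¹) := by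
    intro g
    simp [ψ, div_eq_mul_inv]
  have hsurj : Function.Surjective ψ := by
    have h1 : (⊤ : Subgroup D) ≤ ψ.range.comap Abelianization.of := by
      rw [← hgen, Subgroup.closure_le]
      rintro z ⟨g, rfl⟩
      exact ⟨Abelianization.of g, hψ g⟩
    intro t
    obtain ⟨t, rfl⟩ := QuotientGroup.mk'_surjective (commutator _) t
    exact h1 (Subgroup.mem_top t)
  have hinj : Function.Injective ψ := Finite.injective_iff_surjective.2 hsurj
  have hle : MulAction.stabilizer D a ≤ commutator D := by
    intro g hg
    have h1 : φ g = g := hfix g hg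
    have h2 : ψ (Abelianization.of g) = 1 := by rw [hψ, h1]; simp
    have h3 : Abelianization.of g = 1 := hinj (by rw [h2, map_one])
    rwa [← MonoidHom.mem_ker, Abelianization.ker_of] at h3
  have hidx : (MulAction.stabilizer D a).index = p ^ 2 := by
    rw [MulAction.index_stabilizer_of_transitive, hcard]
  obtain ⟨k, hk, hk2⟩ := (Nat.dvd_prime_pow hp).1 (hidx ▸ Subgroup.index_dvd_of_le hle)
  by_cases hk' : k = 2
  · have hmul := Subgroup.relIndex_mul_index hle
    rw [hk2, hidx, hk'] at hmul
    have h1 : (MulAction.stabilizer D a).relIndex (commutator D) = 1 :=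
      Nat.eq_of_mul_eq_mul_right (pow_pos hp.pos 2) (by rw [hmul, one_mul])
    have hle2 : commutator D ≤ MulAction.stabilizer D a := Subgroup.relIndex_eq_one.1 h1
    have hone : ∀ z ∈ commutator D, z = 1 := by
      intro z hz
      apply FaithfulSMul.eq_of_smul_eq_smul (α := Q)
      intro b
      obtain ⟨g, rfl⟩ := MulAction.exists_smul_eq D a b
      have hz2 : g⁻¹ * z * g ∈ commutator D := by
        simpa using Subgroup.Normal.conj_mem inferInstance z hz g⁻¹
      have hz3 : (g⁻¹ * z * g) • a = a := hle2 hz2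
      rw [mul_assoc, mul_smul, inv_smul_eq_iff, mul_smul] at hz3
      rw [hz3, one_smul]
    intro g h
    have := hone (g * h * g⁻¹ * h⁻¹)
      (Subgroup.commutator_mem_commutator (Subgroup.mem_top g) (Subgroup.mem_top h))
    rw [mul_inv_eq_one, mul_inv_eq_iff_eq_mul] at this
    exact this
  · apply comm_of_cyclic_abelianization
    have hc : Nat.card (Abelianization D) = p ^ k := hk2
    have : k = 0 ∨ k = 1 := by omega
    rcases this with rfl | rfl
    · have : Subsingleton (Abelianization D) := (Nat.card_eq_one_iff_unique.1 (by simpa using hc)).1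
      infer_instance
    · exact isCyclic_of_prime_card (p := p) (by simpa using hc)

section QuandlePart

variable {Q : Type u} [Quandle Q]

theorem QL_self (a : Q) : QL a a = a := Quandle.fix

theorem QL_conj {g : Equiv.Perm Q} (hg : g ∈ Subgroup.closure (Set.range (QL (Q := Q)))) :
    ∀ b : Q, QL (g b) = g * QL b * g⁻¹ := by
  induction hg using Subgroup.closure_induction with
  | mem g h =>
    obtain ⟨a, rfl⟩ := h
    intro b
    exact Rack.ad_conj a b
  | one => intro b; simp
  | mul g h _ _ ihg ihh =>
    intro b
    rw [Equiv.Perm.mul_apply, ihg, ihh]; group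
  | inv g _ ih =>
    intro b
    have h1 := ih (g⁻¹ b)
    rw [← Equiv.Perm.mul_apply, mul_inv_cancel, Equiv.Perm.one_apply] at h1
    rw [h1]; group

theorem Dis_le : Dis Q ≤ Subgroup.closure (Set.range (QL (Q := Q))) := by
  rw [Dis, Subgroup.closure_le]
  rintro g ⟨a, b, rfl⟩
  exact mul_mem (Subgroup.subset_closure ⟨a, rfl⟩) (inv_mem (Subgroup.subset_closure ⟨b, rfl⟩))

theorem Dis_conj {g d : Equiv.Perm Q} (hg : g ∈ Subgroup.closure (Set.range (QL (Q := Q))))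
    (hd : d ∈ Dis Q) : g * d * g⁻¹ ∈ Dis Q := by
  have h : Dis Q ≤ (Dis Q).comap (MulAut.conj g).toMonoidHom := by
    conv_lhs => rw [Dis]
    rw [Subgroup.closure_le]
    rintro z ⟨a, b, rfl⟩
    apply Subgroup.subset_closure
    refine ⟨g a, g b, ?_⟩
    rw [QL_conj hg, QL_conj hg]
    simp [mul_assoc]
  simpa using h hd

theorem Dis_isPGroup [Finite Q] {p : ℕ} (hp : p.Prime)
    (hconn : ∀ x y : Q, ∃ g ∈ Dis Q, g x = y) (hcard : Nat.card Q = p ^ 2) (a : Q) :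
    IsPGroup p (Dis Q) := by
  classical
  have := Fact.mk hp
  set G := Subgroup.closure (Set.range (QL (Q := Q))) with hGdef
  have := Fintype.ofFinite G
  let ql : Q → G := fun b => ⟨QL b, Subgroup.subset_closure ⟨b, rfl⟩⟩
  have hql : ∀ (g : G) (b : Q), ql ((g : Equiv.Perm Q) b) = g * ql b * g⁻¹ := fun g b =>
    Subtype.ext (QL_conj g.2 b)
  have htrans : ∀ b c : Q, ∃ g : G, (g : Equiv.Perm Q) b = c := by
    intro b c
    obtain ⟨g, hg, h⟩ := hconn b c
    exact ⟨⟨g, Dis_le hg⟩, h⟩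
  have hconj : ∀ g : G, IsConj (ql a) g ↔ ∃ b, ql b = g := by
    intro g
    rw [isConj_iff]
    constructor
    · rintro ⟨c, rfl⟩
      exact ⟨_, hql c a⟩
    · rintro ⟨b, rfl⟩
      obtain ⟨c, rfl⟩ := htrans a b
      exact ⟨c, (hql c a).symm⟩
  have hgen : Subgroup.closure {g : G | IsConj (ql a) g} = ⊤ := by
    rw [← Subgroup.closure_closure_coe_preimage (k := Set.range (QL (Q := Q)))]
    congr 1
    ext g
    rw [Set.mem_setOf_eq, hconj]
    constructor
    · rintro ⟨b, rfl⟩; exact ⟨b, rfl⟩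
    · rintro ⟨b, hb⟩; exact ⟨b, Subtype.ext hb⟩
  have hdvd : Nat.card {g : G | IsConj (ql a) g} ∣ p ^ 2 := by
    rw [← hcard]
    let F : Q → {g : G | IsConj (ql a) g} := fun b => ⟨ql b, (hconj _).2 ⟨b, rfl⟩⟩
    have hF : ∀ c, Nat.card {b // F b = c} = Nat.card {b // ql b = ql a} := by
      rintro ⟨c, hc⟩
      obtain ⟨k, rfl⟩ := isConj_iff.1 hc
      refine (Nat.card_congr (Equiv.subtypeEquiv (k : Equiv.Perm Q) ?_)).symm
      intro b
      rw [Subtype.ext_iff (a1 := F _)]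
      change _ ↔ ql _ = _
      rw [hql]
      simp
    have h1 := Nat.card_congr (Equiv.sigmaFiberEquiv F)
    rw [Nat.card_sigma, Finset.sum_congr rfl fun c _ => hF c, Finset.sum_const, smul_eq_mul,
      Finset.card_univ, ← Nat.card_eq_fintype_card] at h1
    exact ⟨_, h1.symm⟩
  obtain ⟨j, -, hj⟩ := (Nat.dvd_prime_pow hp).1 hdvd
  have hcomm : IsPGroup p (commutator G) := by
    apply IsPGroup.of_card
    refine Nat.eq_prime_pow_of_unique_prime_dvd (p := p) Nat.card_pos.ne' ?_
    intro q hq hqd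
    by_contra hne
    have := Fact.mk hq
    obtain ⟨y, hy⟩ := exists_prime_orderOf_dvd_card' q hqd
    exact burnside_like hp hq hne hgen hj y.2 (by rw [Subgroup.orderOf_coe, hy])
  have hle : Dis Q ≤ (commutator G).map G.subtype := by
    rw [Dis, Subgroup.closure_le]
    rintro z ⟨b, c, rfl⟩
    obtain ⟨g, rfl⟩ := htrans c b
    refine ⟨g * ql c * g⁻¹ * (ql c)⁻¹,
      Subgroup.commutator_mem_commutator (Subgroup.mem_top _) (Subgroup.mem_top _), ?_⟩
    rw [← hql]; rfl
  exact (hcomm.map G.subtype).to_le hle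

end QuandlePart

theorem stmt13 (p : ℕ) (hp : p.Prime) (Q : Type u) [Quandle Q]
    (hconn : ∀ x y : Q, ∃ g ∈ Dis Q, g x = y)
    (hcard : Nat.card Q = p ^ 2) :
    IsAffine Q := by
  have hpos : 0 < Nat.card Q := by rw [hcard]; exact pow_pos hp.pos 2
  obtain ⟨hne, hfin⟩ := Nat.card_pos_iff.1 hpos
  obtain ⟨a⟩ := hne
  have hP := Dis_isPGroup hp hconn hcard a
  have hxG : QL a ∈ Subgroup.closure (Set.range (QL (Q := Q))) := Subgroup.subset_closure ⟨a, rfl⟩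
  let φ : Dis Q ≃* Dis Q :=
    { toFun := fun d => ⟨QL a * d * (QL a)⁻¹, Dis_conj hxG d.2⟩
      invFun := fun d => ⟨(QL a)⁻¹ * d * QL a, by simpa using Dis_conj (inv_mem hxG) d.2⟩
      left_inv := fun d => Subtype.ext (by simp [mul_assoc])
      right_inv := fun d => Subtype.ext (by simp [mul_assoc])
      map_mul' := fun d e => Subtype.ext (by simp [mul_assoc]) }
  have hφ : ∀ d : Dis Q, (φ d : Equiv.Perm Q) = QL a * d * (QL a)⁻¹ := fun d => rfl
  have htr : MulAction.IsPretransitive (Dis Q) Q := ⟨fun x y => by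
    obtain ⟨g, hg, h⟩ := hconn x y
    exact ⟨⟨g, hg⟩, h⟩⟩
  have hcomm : ∀ g h : Dis Q, g * h = h * g := by
    refine comm_of_data hp hcard hP φ.toMonoidHom a ?_ ?_
    · intro g hg
      apply Subtype.ext
      change QL a * (g : Equiv.Perm Q) * (QL a)⁻¹ = g
      have h1 := QL_conj (Dis_le g.2) a
      have h2 : (g : Equiv.Perm Q) a = a := hg
      rw [h2, eq_mul_inv_iff_mul_eq] at h1
      rw [h1, mul_inv_cancel_right]
    · set K := Subgroup.closure {z : Dis Q | ∃ g, z = g * (φ.toMonoidHom g)⁻¹} with hK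
      have hb : ∀ b : Q, ∃ k ∈ K, (k : Equiv.Perm Q) = QL b * (QL a)⁻¹ := by
        intro b
        obtain ⟨g, hg, rfl⟩ := hconn a b
        refine ⟨_, Subgroup.subset_closure ⟨⟨g, hg⟩, rfl⟩, ?_⟩
        change g * (QL a * g * (QL a)⁻¹)⁻¹ = _
        rw [QL_conj (Dis_le hg)]
        group
      have hle : Dis Q ≤ K.map (Dis Q).subtype := by
        conv_lhs => rw [Dis]
        rw [Subgroup.closure_le]
        rintro z ⟨b, c, rfl⟩
        obtain ⟨k, hk, hk2⟩ := hb b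
        obtain ⟨l, hl, hl2⟩ := hb c
        refine ⟨k * l⁻¹, mul_mem hk (inv_mem hl), ?_⟩
        change (k : Equiv.Perm Q) * (l : Equiv.Perm Q)⁻¹ = _
        rw [hk2, hl2]; group
      rw [eq_top_iff]
      rintro d -
      obtain ⟨k, hk, hk2⟩ := hle d.2
      have : k = d := Subtype.ext hk2
      rwa [← this]
  let inst : CommGroup (Dis Q) := { (inferInstance : Group (Dis Q)) with mul_comm := hcomm }
  have hbij : Function.Bijective fun g : Dis Q => (g : Equiv.Perm Q) a := by
    constructor
    · intro g h hgh
      apply Subtype.ext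
      ext b
      obtain ⟨k, hk, rfl⟩ := hconn a b
      have e1 : (g : Equiv.Perm Q) * k = k * g := congrArg Subtype.val (hcomm g ⟨k, hk⟩)
      have e2 : (h : Equiv.Perm Q) * k = k * h := congrArg Subtype.val (hcomm h ⟨k, hk⟩)
      rw [← Equiv.Perm.mul_apply, ← Equiv.Perm.mul_apply, e1, e2, Equiv.Perm.mul_apply,
        Equiv.Perm.mul_apply]
      exact congrArg k hgh
    · intro b
      obtain ⟨g, hg, h⟩ := hconn a b
      exact ⟨⟨g, hg⟩, h⟩
  let E : Dis Q ≃ Q := Equiv.ofBijective _ hbij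
  have hE : ∀ g : Dis Q, E g = (g : Equiv.Perm Q) a := fun g => rfl
  refine ⟨Additive (Dis Q), inferInstance, MulEquiv.toAdditive φ, E.symm.trans Additive.ofMul, ?_⟩
  intro b c
  obtain ⟨g, rfl⟩ := E.surjective b
  obtain ⟨h, rfl⟩ := E.surjective c
  have key : E g ◃ E h = E (g / φ g * φ h) := by
    have hinv : (QL a)⁻¹ a = a := by
      rw [Equiv.Perm.inv_eq_iff_eq]; exact (QL_self a).symm
    rw [div_eq_mul_inv, hE, hE, hE]
    change QL ((g : Equiv.Perm Q) a) ((h : Equiv.Perm Q) a) =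
      ((g : Equiv.Perm Q) * (QL a * g * (QL a)⁻¹)⁻¹ * (QL a * h * (QL a)⁻¹)) a
    rw [QL_conj (Dis_le g.2)]
    simp only [Equiv.Perm.mul_apply, mul_inv_rev, inv_inv, hinv]
    simp
  rw [key]
  simp only [Equiv.trans_apply, Equiv.symm_apply_apply]
  rfl
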